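/- arXiv:1706.03724 — 2 statements merged into one kernel-verified Lean document; each statement's English description precedes it below -/
import Mathlib

section
/- Fix y > k̲ and x > y. Then for every a ∈ (k̲, y), the partial derivative ∂_a Δ(x, a; y) = −W^{(r,q)}(x, a)·( q·v̲(a) − χ(a) ) is strictly negative; in particular the map a ↦ Δ(x, a; y) is strictly decreasing on (k̲, y). -/
open MeasureTheory Real Set Filter Topology

/-- Two finite measures on `ℝ` with equal moment-generating functions near `0` coincide. -/
theorem measure_ext_of_mgf_eq_of_lt {m₁ m₂ : Measure ℝ} [IsFiniteMeasure m₁] [IsFiniteMeasure m₂]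
    {c : ℝ} (hc : 0 < c)
    (h₁ : ∀ t < c, Integrable (fun x => exp (t * x)) m₁)
    (h₂ : ∀ t < c, Integrable (fun x => exp (t * x)) m₂)
    (h : ∀ t < c, ∫ x, exp (t * x) ∂m₁ = ∫ x, exp (t * x) ∂m₂) : m₁ = m₂ := by
  have sub : ∀ m : Measure ℝ, (∀ t < c, Integrable (fun x => exp (t * x)) m) →
      {z : ℂ | z.re < c} ⊆ {z | z.re ∈ interior (ProbabilityTheory.integrableExpSet id m)} := by
    intro m hm z hz
    exact interior_maximal (fun t ht => hm t ht) isOpen_Iio hz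
  have a₁ := (ProbabilityTheory.analyticOnNhd_complexMGF (X := id) (μ := m₁)).mono (sub m₁ h₁)
  have a₂ := (ProbabilityTheory.analyticOnNhd_complexMGF (X := id) (μ := m₂)).mono (sub m₂ h₂)
  have key : EqOn (ProbabilityTheory.complexMGF id m₁) (ProbabilityTheory.complexMGF id m₂)
      {z : ℂ | z.re < c} := by
    refine a₁.eqOn_of_preconnected_of_frequently_eq a₂
      (convex_halfSpace_re_lt c).isPreconnected (z₀ := 0) (by simpa using hc) ?_
    have hseq : Tendsto (fun n : ℕ => ((-(1 / ((n : ℝ) + 1)) : ℝ) : ℂ)) atTop (𝓝[≠] 0) := by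
      refine tendsto_nhdsWithin_iff.2 ⟨?_, Eventually.of_forall fun n => ?_⟩
      · have := (tendsto_one_div_add_atTop_nhds_zero_nat (𝕜 := ℝ)).neg
        simpa [Function.comp_def] using (Complex.continuous_ofReal.tendsto _).comp this
      · have : (0 : ℝ) < 1 / ((n : ℝ) + 1) := by positivity
        exact Complex.ofReal_ne_zero.2 (by linarith)
    refine hseq.frequently (Frequently.of_forall fun n => ?_)
    rw [ProbabilityTheory.complexMGF_ofReal, ProbabilityTheory.complexMGF_ofReal]
    have : (0 : ℝ) < 1 / ((n : ℝ) + 1) := by positivity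
    exact congrArg _ (h _ (by linarith))
  refine Measure.ext_of_charFun (funext fun t => ?_)
  rw [← ProbabilityTheory.complexMGF_id_mul_I, ← ProbabilityTheory.complexMGF_id_mul_I]
  exact key (by simpa using hc)

/-- Uniqueness for Laplace transforms of nonnegative continuous functions. -/
theorem eqOn_of_laplace_eq {f g : ℝ → ℝ} (hf : Continuous f) (hg : Continuous g)
    (hf0 : ∀ x, 0 ≤ f x) (hg0 : ∀ x, 0 ≤ g x) {b : ℝ}
    (hfi : ∀ β, b < β → IntegrableOn (fun x => exp (-β * x) * f x) (Ioi 0))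
    (hgi : ∀ β, b < β → IntegrableOn (fun x => exp (-β * x) * g x) (Ioi 0))
    (h : ∀ β, b < β →
      ∫ x in Ioi 0, exp (-β * x) * f x = ∫ x in Ioi 0, exp (-β * x) * g x) :
    EqOn f g (Ioi 0) := by
  have exp_int : ∀ k : ℝ → ℝ, Continuous k → (∀ x, 0 ≤ k x) →
      (∀ β, b < β → IntegrableOn (fun x => exp (-β * x) * k x) (Ioi 0)) → ∀ t < (1 : ℝ),
      Integrable (fun x => exp (t * x)) ((volume.restrict (Ioi 0)).withDensity
        fun x => ENNReal.ofReal (exp (-(b + 1) * x) * k x)) ∧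
      ∫ x, exp (t * x) ∂((volume.restrict (Ioi 0)).withDensity
        fun x => ENNReal.ofReal (exp (-(b + 1) * x) * k x)) =
          ∫ x in Ioi 0, exp (-(b + 1 - t) * x) * k x := by
    intro k hk hk0 hki t ht
    have hm : Measurable fun x => ENNReal.ofReal (exp (-(b + 1) * x) * k x) := by fun_prop
    have e : (fun x => (ENNReal.ofReal (exp (-(b + 1) * x) * k x)).toReal • exp (t * x)) =
        fun x => exp (-(b + 1 - t) * x) * k x := by
      funext x
      rw [ENNReal.toReal_ofReal (mul_nonneg (exp_pos _).le (hk0 x)), smul_eq_mul,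
        mul_right_comm, ← exp_add]
      ring_nf
    constructor
    · rw [integrable_withDensity_iff_integrable_smul' hm (by simp), e]
      exact hki _ (by linarith)
    · rw [integral_withDensity_eq_integral_toReal_smul hm (by simp), e]
  have fin : ∀ k : ℝ → ℝ,
      (∀ β, b < β → IntegrableOn (fun x => exp (-β * x) * k x) (Ioi 0)) →
      IsFiniteMeasure ((volume.restrict (Ioi 0)).withDensity
        fun x => ENNReal.ofReal (exp (-(b + 1) * x) * k x)) := fun k hk =>
    isFiniteMeasure_withDensity_ofReal (hk (b + 1) (by linarith)).2
  have := fin f hfi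
  have := fin g hgi
  have hm := measure_ext_of_mgf_eq_of_lt one_pos (fun t ht => (exp_int f hf hf0 hfi t ht).1)
    (fun t ht => (exp_int g hg hg0 hgi t ht).1) fun t ht => by
      rw [(exp_int f hf hf0 hfi t ht).2, (exp_int g hg hg0 hgi t ht).2, h _ (by linarith)]
  rw [withDensity_eq_iff_of_sigmaFinite (by fun_prop) (by fun_prop)] at hm
  refine Measure.eqOn_open_of_ae_eq (μ := volume) ?_ isOpen_Ioi hf.continuousOn hg.continuousOn
  filter_upwards [hm] with x hx
  have := (ENNReal.ofReal_eq_ofReal_iff (mul_nonneg (exp_pos _).le (hf0 x))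
    (mul_nonneg (exp_pos _).le (hg0 x))).1 hx
  exact mul_left_cancel₀ (exp_pos _).ne' this

/-- The resolvent identity for scale functions, from their Laplace transforms. -/
theorem laplace_resolvent_identity {u w ψ : ℝ → ℝ} {r q b : ℝ} (hq : 0 < q)
    (hu : Continuous u) (hw : Continuous w) (hu0 : ∀ x, 0 ≤ u x) (hw0 : ∀ x, 0 ≤ w x)
    (hψ : ∀ β, b < β → r + q < ψ β)
    (hlu : ∀ β, b < β → ∫ x in Ioi 0, exp (-β * x) * u x = 1 / (ψ β - r))
    (hlw : ∀ β, b < β → ∫ x in Ioi 0, exp (-β * x) * w x = 1 / (ψ β - (r + q)))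
    {x : ℝ} (hx : 0 < x) :
    w x = u x + q * ∫ t in (0 : ℝ)..x, w t * u (x - t) := by
  have hui : ∀ β, b < β → IntegrableOn (fun x => exp (-β * x) * u x) (Ioi 0) := fun β hβ => by
    by_contra hc
    have h1 := hlu β hβ
    rw [integral_undef hc] at h1
    have := hψ β hβ
    exact (one_div_pos.2 (by linarith : 0 < ψ β - r)).ne h1
  have hwi : ∀ β, b < β → IntegrableOn (fun x => exp (-β * x) * w x) (Ioi 0) := fun β hβ => by
    by_contra hc
    have h1 := hlw β hβ
    rw [integral_undef hc] at h1
    have := hψ β hβ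
    exact (one_div_pos.2 (by linarith : 0 < ψ β - (r + q))).ne h1
  set k : ℝ → ℝ := fun x => ∫ t in (0 : ℝ)..max x 0, w t * u (x - t) with hk
  have hkc : Continuous k := by
    refine intervalIntegral.continuous_parametric_intervalIntegral_of_continuous ?_ (by fun_prop)
    fun_prop
  have hk0 : ∀ x, 0 ≤ k x := fun x =>
    intervalIntegral.integral_nonneg (le_max_right _ _) fun t _ => mul_nonneg (hw0 _) (hu0 _)
  have conv : ∀ β, EqOn (fun x => exp (-β * x) * k x) (fun x => ∫ t in (0 : ℝ)..x,
      ContinuousLinearMap.mul ℝ ℝ (exp (-β * t) * w t) (exp (-β * (x - t)) * u (x - t)))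
      (Ioi 0) := by
    intro β x hx
    simp only [hk, max_eq_left (le_of_lt (mem_Ioi.1 hx))]
    rw [← intervalIntegral.integral_const_mul]
    refine intervalIntegral.integral_congr fun t _ => ?_
    simp only [ContinuousLinearMap.mul_apply']
    rw [show exp (-β * x) = exp (-β * t) * exp (-β * (x - t)) by rw [← exp_add]; ring_nf]
    ring
  have hki : ∀ β, b < β → IntegrableOn (fun x => exp (-β * x) * k x) (Ioi 0) := fun β hβ => by
    refine IntegrableOn.congr_fun ?_ (conv β).symm measurableSet_Ioi
    have := integrable_posConvolution (hwi β hβ) (hui β hβ) (ContinuousLinearMap.mul ℝ ℝ)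
    exact (integrable_indicator_iff measurableSet_Ioi).1 this
  have hlk : ∀ β, b < β → ∫ x in Ioi 0, exp (-β * x) * k x =
      1 / (ψ β - (r + q)) * (1 / (ψ β - r)) := fun β hβ => by
    rw [setIntegral_congr_fun measurableSet_Ioi (conv β),
      integral_posConvolution (hwi β hβ) (hui β hβ), hlu β hβ, hlw β hβ,
      ContinuousLinearMap.mul_apply']
  have split : ∀ β, (fun x => exp (-β * x) * (u x + q * k x)) =
      fun x => exp (-β * x) * u x + q * (exp (-β * x) * k x) := fun β => by
    funext x; ring
  have main := eqOn_of_laplace_eq (f := w) (g := fun x => u x + q * k x) (b := b) hw (by fun_prop)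
    hw0 (fun x => add_nonneg (hu0 x) (mul_nonneg hq.le (hk0 x))) hwi
    (fun β hβ => by
      rw [split]
      exact (hui β hβ).add ((hki β hβ).const_mul q))
    (fun β hβ => by
      rw [split, integral_add (hui β hβ) ((hki β hβ).const_mul q), integral_const_mul, hlk β hβ,
        hlu β hβ, hlw β hβ]
      have := hψ β hβ
      have h1 : ψ β - r ≠ 0 := by intro h; linarith
      have h2 : ψ β - (r + q) ≠ 0 := by intro h; linarith
      field_simp
      ring)
  have := main hx
  simpa only [hk, max_eq_left hx.le] using this

/-- The compensated exponential in the Lévy–Khintchine formula is integrable. -/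
theorem integrable_compensated_exp {ν : Measure ℝ} (hν : ν (Ici 0) = 0)
    (hνint : ∫⁻ x, ENNReal.ofReal (min 1 (x ^ 2)) ∂ν ≠ ⊤) {β : ℝ} (hβ : 0 ≤ β) :
    Integrable (fun z => exp (β * z) - 1 - (Ioi (-1 : ℝ)).indicator (fun t => β * t) z) ν := by
  have hb : Integrable (fun x : ℝ => (1 + β ^ 2) * min 1 (x ^ 2)) ν := by
    refine Integrable.const_mul ⟨by fun_prop, ?_⟩ _
    rw [hasFiniteIntegral_iff_ofReal (Eventually.of_forall fun x => le_min zero_le_one (sq_nonneg x))]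
    exact hνint.lt_top
  have hneg : ∀ᵐ z ∂ν, z < 0 := by
    rw [ae_iff]
    simpa [Ici] using hν
  refine hb.mono' ?_ ?_
  · exact (((by fun_prop : Measurable fun z : ℝ => exp (β * z) - 1)).sub
      ((by fun_prop : Measurable fun z : ℝ => β * z).indicator measurableSet_Ioi)).aestronglyMeasurable
  · filter_upwards [hneg] with z hz
    have hβz : β * z ≤ 0 := mul_nonpos_of_nonneg_of_nonpos hβ hz.le
    have hexp : exp (β * z) ≤ 1 := exp_le_one_iff.2 hβz
    by_cases h1 : -1 < z
    · rw [indicator_of_mem (show z ∈ Ioi (-1 : ℝ) from h1), min_eq_right (by nlinarith), norm_eq_abs]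
      have h0 := add_one_le_exp (β * z)
      rw [abs_of_nonneg (by linarith)]
      by_cases h2 : -1 ≤ β * z
      · have := abs_exp_sub_one_sub_id_le (x := β * z) (abs_le.2 ⟨h2, by linarith⟩)
        have := (abs_le.1 this).2
        nlinarith [sq_nonneg z]
      · nlinarith [sq_nonneg z]
    · rw [indicator_of_notMem (show z ∉ Ioi (-1 : ℝ) from h1), min_eq_left (by nlinarith), norm_eq_abs,
        sub_zero, abs_of_nonpos (by linarith)]
      nlinarith [exp_pos (β * z), sq_nonneg β]

/-- For `1 ≤ c`, `u ↦ exp (c * u) - c * exp u` is nonincreasing on the nonpositive half-line. -/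
theorem antitoneOn_exp_mul_sub_mul_exp {c : ℝ} (hc : 1 ≤ c) :
    AntitoneOn (fun u => exp (c * u) - c * exp u) (Iic 0) := by
  have hd : ∀ u, HasDerivAt (fun u => exp (c * u) - c * exp u) (exp (c * u) * c - c * exp u) u :=
    fun u => by
      have h1 : HasDerivAt (fun u => exp (c * u)) (exp (c * u) * c) u := by
        simpa using ((hasDerivAt_id u).const_mul c).exp
      exact h1.sub ((Real.hasDerivAt_exp u).const_mul c)
  refine antitoneOn_of_deriv_nonpos (convex_Iic 0) (by fun_prop)
    (fun u _ => (hd u).differentiableAt.differentiableWithinAt) fun u hu => ?_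
  rw [interior_Iic] at hu
  rw [(hd u).deriv]
  have : exp (c * u) ≤ exp u := exp_le_exp.2 (by nlinarith [mem_Iio.1 hu])
  nlinarith

/-- Translates of a nonnegative nonincreasing continuous function that is `ν`-integrable at `k`
have a continuous nonincreasing integral to the right of `k`. -/
theorem continuous_antitone_integral_translate {ν : Measure ℝ} {h : ℝ → ℝ} {k : ℝ}
    (hc : Continuous h) (ha : Antitone h) (h0 : ∀ x, 0 ≤ h x)
    (hi : Integrable (fun w => h (k + w)) ν) :
    Continuous (fun x => ∫ w, h (max x k + w) ∂ν) ∧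
      Antitone (fun x => ∫ w, h (max x k + w) ∂ν) := by
  have hb : ∀ x, ∀ᵐ w ∂ν, ‖h (max x k + w)‖ ≤ h (k + w) := fun x =>
    Eventually.of_forall fun w => by
      rw [norm_of_nonneg (h0 _)]
      exact ha (add_le_add_left (le_max_right _ _) _)
  have hm : ∀ x, AEStronglyMeasurable (fun w => h (max x k + w)) ν := fun x =>
    (hc.comp (by fun_prop)).aestronglyMeasurable
  refine ⟨continuous_of_dominated hm hb hi (Eventually.of_forall fun w => by fun_prop), ?_⟩
  intro x y hxy
  exact integral_mono (hi.mono' (hm y) (hb y)) (hi.mono' (hm x) (hb x)) fun w =>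
    ha (add_le_add_left (max_le_max_right _ hxy) _)

/-- Derivative in the lower endpoint of the integral over `(t, y)` of a function that agrees with
a continuous one on `(k, y)`. -/
theorem hasDerivAt_setIntegral_Ioo_left {F G : ℝ → ℝ} (hG : Continuous G) {k y c : ℝ}
    (hFG : ∀ w ∈ Ioo k y, F w = G w) {a : ℝ} (ha : a ∈ Ioo k y) :
    HasDerivAt (fun t => (∫ w in Ioo t y, F w) - c) (-(F a)) a := by
  rw [hFG a ha]
  refine HasDerivAt.congr_of_eventuallyEq ((intervalIntegral.integral_hasDerivAt_left
    (hG.intervalIntegrable a y) (hG.stronglyMeasurableAtFilter _ _) hG.continuousAt).sub_const c) ?_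
  filter_upwards [Ioo_mem_nhds ha.1 ha.2] with t ht
  rw [intervalIntegral.integral_of_le ht.2.le, integral_Ioc_eq_integral_Ioo,
    setIntegral_congr_fun measurableSet_Ioo fun w hw => hFG w ⟨ht.1.trans hw.1, hw.2⟩]

/-- Display (4.35) (`eq:inverse`): for fixed `y > k̲` and `x > y`, the map
`a ↦ Δ(x,a;y)` has derivative `−W^{(r,q)}(x,a)·(q·v̲(a) − χ(a)) < 0` at every
`a ∈ (k̲, y)`, hence is strictly decreasing on `(k̲, y)`. -/
theorem stmt13
    (μ σ : ℝ) (ν : MeasureTheory.Measure ℝ)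
    (hν : ν (Set.Ici 0) = 0)
    (hνint : ∫⁻ x, ENNReal.ofReal (min 1 (x ^ 2)) ∂ν ≠ ⊤)
    (ψ : ℝ → ℝ)
    (hψ : ∀ β : ℝ, 0 ≤ β →
      ψ β = μ * β + σ ^ 2 / 2 * β ^ 2 +
        ∫ z, (Real.exp (β * z) - 1 -
          Set.indicator (Set.Ioi (-1 : ℝ)) (fun t => β * t) z) ∂ν)
    (Φ : ℝ → ℝ)
    (hΦ : ∀ s : ℝ, 0 ≤ s → 0 ≤ Φ s ∧ ψ (Φ s) = s ∧ ∀ β : ℝ, Φ s < β → s < ψ β)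
    (r q : ℝ) (hr : 0 < r) (hq : 0 < q)
    (W : ℝ → ℝ → ℝ)
    (hWnn : ∀ s : ℝ, 0 ≤ s → ∀ x : ℝ, 0 ≤ W s x)
    (hWzero : ∀ s : ℝ, 0 ≤ s → ∀ x : ℝ, x < 0 → W s x = 0)
    (hWpos : ∀ s : ℝ, 0 ≤ s → ∀ x : ℝ, 0 < x → 0 < W s x)
    (hWcont : ∀ s : ℝ, 0 ≤ s → ContinuousOn (W s) (Set.Ici 0))
    (hWmono : ∀ s : ℝ, 0 ≤ s → MonotoneOn (W s) (Set.Ici 0))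
    (hWlap : ∀ s : ℝ, 0 ≤ s → ∀ β : ℝ, Φ s < β →
      ∫ x in Set.Ioi (0 : ℝ), Real.exp (-β * x) * W s x = 1 / (ψ β - s))
    (hrψ : ψ 1 < r)
    (K : ℝ) (hK : 0 < K)
    (Kl kl : ℝ)
    (hKl : Kl = Φ (r + q) * K / (Φ (r + q) - 1))
    (hkl : kl = Real.log Kl)
    (v : ℝ → ℝ)
    (hv1 : ∀ x : ℝ, x ≤ kl → v x = (Kl - K) * Real.exp (Φ (r + q) * (x - kl)))
    (hv2 : ∀ x : ℝ, kl < x → v x = Real.exp x - K)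
    (h : ℝ → ℝ) (hh : ∀ x : ℝ, h x = v x - (Real.exp x - K))
    (h' : ℝ → ℝ) (hh' : ∀ x : ℝ, HasDerivAt h (h' x) x)
    (f : ℝ → ℝ)
    (hf : ∀ x : ℝ, kl ≤ x → f x = ∫ w in Set.Iio (kl - x), h (x + w) ∂ν)
    (χ : ℝ → ℝ)
    (hχ1 : ∀ x : ℝ, kl ≤ x → χ x = r * K - (r - ψ 1) * Real.exp x + f x)
    (hχ2 : ∀ x : ℝ, x < kl → χ x = q * v x)
    (y x : ℝ) (hy : kl < y) (hx : y < x)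
    (WW : ℝ → ℝ → ℝ)
    (hWW : ∀ x' b : ℝ, WW x' b =
      W (r + q) (x' - b) - q * ∫ z in Set.Ioo y (max x' y), W r (x' - z) * W (r + q) (z - b))
    (Δ : ℝ → ℝ → ℝ)
    (hΔ : ∀ x' b : ℝ, Δ x' b =
      (∫ w in Set.Ioo b y, WW x' w * (q * v w - χ w)) -
        ∫ w in Set.Ico y (max x' y), W r (x' - w) * χ w) :
    (∀ a ∈ Set.Ioo kl y,
      HasDerivAt (fun t => Δ x t) (-(WW x a * (q * v a - χ a))) a ∧
      -(WW x a * (q * v a - χ a)) < 0) ∧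
    StrictAntiOn (fun t => Δ x t) (Set.Ioo kl y) := by
  have hp : 0 ≤ r + q := by linarith
  obtain ⟨hφ0, hψφ, hψgt⟩ := hΦ (r + q) hp
  set φ := Φ (r + q) with hφ
  have hφ1 : 1 < φ := by
    rcases lt_trichotomy φ 1 with h1 | h1 | h1
    · linarith [hψgt 1 h1]
    · rw [h1] at hψφ; linarith
    · exact h1
  have hφ1' : 0 < φ - 1 := by linarith
  have hKlpos : 0 < Kl := by rw [hKl]; positivity
  have hKlK : Kl - K = K / (φ - 1) := by rw [hKl]; field_simp; ring
  have hexpkl : exp kl = φ * (K / (φ - 1)) := by rw [hkl, exp_log hKlpos, hKl]; ring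
  have hc0 : 0 < K / (φ - 1) := by positivity
  have hcK : K = K / (φ - 1) * (φ - 1) := by field_simp
  have hleft : ∀ u ≤ 0, h (kl + u) = K / (φ - 1) * (exp (φ * u) - φ * exp u + (φ - 1)) := by
    intro u hu
    rw [hh, hv1 _ (by linarith), hKlK, exp_add, hexpkl, add_sub_cancel_left]
    linear_combination hcK
  have hright : ∀ x, kl ≤ x → h x = 0 := by
    intro x hx
    rcases hx.eq_or_lt with rfl | hx
    · simpa using hleft 0 le_rfl
    · rw [hh, hv2 _ hx, sub_self]
  have hanti : Antitone h := by
    have h1 : AntitoneOn h (Iic kl) := by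
      intro s hs t ht hst
      have hs' : s - kl ≤ 0 := sub_nonpos.2 hs
      have ht' : t - kl ≤ 0 := sub_nonpos.2 ht
      have := antitoneOn_exp_mul_sub_mul_exp hφ1.le hs' ht' (by linarith)
      rw [← add_sub_cancel kl s, ← add_sub_cancel kl t, hleft _ hs', hleft _ ht']
      exact mul_le_mul_of_nonneg_left (by simpa using this) hc0.le
    have h2 : AntitoneOn h (Ici kl) := fun s hs t ht _ => by rw [hright s hs, hright t ht]
    exact h1.Iic_union_Ici h2
  have hnonneg : ∀ x, 0 ≤ h x := fun x => by
    rw [← hright (max x kl) (le_max_right _ _)]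
    exact hanti (le_max_left _ _)
  have hcont : Continuous h := continuous_iff_continuousAt.2 fun x => (hh' x).continuousAt
  have hneg : ∀ᵐ z ∂ν, z < 0 := by
    rw [ae_iff]
    simpa [Ici] using hν
  have i1 := integrable_compensated_exp hν hνint zero_le_one
  have iφ := integrable_compensated_exp hν hνint hφ0
  have hae : (fun w => h (kl + w)) =ᵐ[ν] fun w => K / (φ - 1) *
      ((exp (φ * w) - 1 - (Ioi (-1 : ℝ)).indicator (fun t => φ * t) w) -
        φ * (exp (1 * w) - 1 - (Ioi (-1 : ℝ)).indicator (fun t => 1 * t) w)) := by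
    filter_upwards [hneg] with w hw
    rw [hleft w hw.le, one_mul]
    by_cases hw1 : w ∈ Ioi (-1 : ℝ)
    · rw [indicator_of_mem hw1, indicator_of_mem hw1]; ring
    · rw [indicator_of_notMem hw1, indicator_of_notMem hw1]; ring
  have hint : Integrable (fun w => h (kl + w)) ν :=
    ((iφ.sub (i1.const_mul φ)).const_mul _).congr hae.symm
  obtain ⟨hFc, hFa⟩ := continuous_antitone_integral_translate hcont hanti hnonneg hint
  have hfF : ∀ x, kl ≤ x → f x = ∫ w, h (max x kl + w) ∂ν := fun x hx => by
    rw [hf x hx, max_eq_left hx]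
    refine setIntegral_eq_integral_of_forall_compl_eq_zero fun w hw => hright _ ?_
    linarith [notMem_Iio.1 hw]
  have hfkl : f kl = K / (φ - 1) * ((r + q - (μ * φ + σ ^ 2 / 2 * φ ^ 2)) -
      φ * (ψ 1 - (μ * 1 + σ ^ 2 / 2 * 1 ^ 2))) := by
    rw [hfF kl le_rfl, max_self, integral_congr_ae hae, integral_const_mul,
      integral_sub iφ (i1.const_mul φ), integral_const_mul, ← hψφ, hψ φ hφ0, hψ 1 zero_le_one]
    ring
  have hgen : ∀ a, kl < a →
      q * v a - χ a = (r + q - ψ 1) * exp a - (r + q) * K - f a := fun a ha => by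
    rw [hv2 a ha, hχ1 a ha.le]; ring
  have hgenpos : ∀ a, kl < a → 0 < q * v a - χ a := fun a ha => by
    have h1 : f a ≤ f kl := by
      rw [hfF a ha.le, hfF kl le_rfl]
      exact hFa ha.le
    have h2 : (r + q - ψ 1) * exp kl < (r + q - ψ 1) * exp a :=
      mul_lt_mul_of_pos_left (exp_lt_exp.2 ha) (by linarith)
    have h3 : (r + q - ψ 1) * exp kl - (r + q) * K - f kl =
        K / (φ - 1) * (σ ^ 2 / 2 * (φ * (φ - 1))) := by
      rw [hexpkl, hfkl]
      linear_combination -(r + q) * hcK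
    have h4 : 0 ≤ K / (φ - 1) * (σ ^ 2 / 2 * (φ * (φ - 1))) := by positivity
    rw [hgen a ha]
    linarith
  set V : ℝ → ℝ → ℝ := fun s t => W s (max t 0) with hV
  have hVc : ∀ s, 0 ≤ s → Continuous (V s) := fun s hs =>
    (hWcont s hs).comp_continuous (by fun_prop) fun t => le_max_right t 0
  have hVr := hVc r hr.le
  have hVp := hVc (r + q) hp
  have hVW : ∀ s t, 0 ≤ t → W s t = V s t := fun s t ht => by simp only [hV, max_eq_left ht]
  have hVlap : ∀ s, 0 ≤ s → ∀ β, Φ s < β →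
      ∫ x in Ioi 0, exp (-β * x) * V s x = 1 / (ψ β - s) := fun s hs β hβ => by
    rw [← hWlap s hs β hβ]
    exact setIntegral_congr_fun measurableSet_Ioi fun t ht => by
      simp only [hVW s t (le_of_lt (mem_Ioi.1 ht))]
  have hWWV : ∀ w < y, WW x w =
      V (r + q) (x - w) - q * ∫ z in y..x, V r (x - z) * V (r + q) (z - w) := fun w hw => by
    rw [hWW, max_eq_left hx.le, hVW _ _ (by linarith), intervalIntegral.integral_of_le hx.le,
      integral_Ioc_eq_integral_Ioo]
    congr 2
    refine setIntegral_congr_fun measurableSet_Ioo fun z hz => ?_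
    simp only [hVW r (x - z) (by linarith [hz.2]), hVW (r + q) (z - w) (by linarith [hz.1])]
  have hWWpos : ∀ a < y, 0 < WW x a := fun a ha => by
    have hres := laplace_resolvent_identity (b := max (Φ r) φ) hq hVr hVp
      (fun t => hWnn r hr.le _) (fun t => hWnn (r + q) hp _)
      (fun β hβ => hψgt β ((le_max_right _ _).trans_lt hβ))
      (fun β hβ => hVlap r hr.le β ((le_max_left _ _).trans_lt hβ))
      (fun β hβ => hVlap (r + q) hp β ((le_max_right _ _).trans_lt hβ))
      (show 0 < x - a by linarith)
    have hsub : ∫ t in (0 : ℝ)..(x - a), V (r + q) t * V r (x - a - t) =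
        ∫ z in a..x, V r (x - z) * V (r + q) (z - a) := by
      rw [← sub_self a, ← intervalIntegral.integral_comp_sub_right]
      refine intervalIntegral.integral_congr fun z _ => ?_
      simp only [sub_sub_sub_cancel_right, mul_comm]
    have hII : Continuous fun z => V r (x - z) * V (r + q) (z - a) := by fun_prop
    rw [hsub, ← intervalIntegral.integral_add_adjacent_intervals
      (hII.intervalIntegrable a y) (hII.intervalIntegrable y x)] at hres
    have hnn : 0 ≤ ∫ z in a..y, V r (x - z) * V (r + q) (z - a) :=
      intervalIntegral.integral_nonneg ha.le fun z _ =>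
        mul_nonneg (hWnn r hr.le _) (hWnn (r + q) hp _)
    have hpos : 0 < V r (x - a) := hWpos r hr.le _ (lt_max_of_lt_left (by linarith))
    rw [hWWV a ha, hres]
    nlinarith [mul_nonneg hq.le hnn]
  have hder : ∀ a ∈ Ioo kl y,
      HasDerivAt (fun t => Δ x t) (-(WW x a * (q * v a - χ a))) a := by
    intro a ha
    simp only [hΔ]
    refine hasDerivAt_setIntegral_Ioo_left (F := fun w => WW x w * (q * v w - χ w))
      (G := fun w => (V (r + q) (x - w) - q * ∫ z in y..x, V r (x - z) * V (r + q) (z - w)) *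
        ((r + q - ψ 1) * exp w - (r + q) * K - ∫ u, h (max w kl + u) ∂ν)) ?_ (fun w hw => ?_) ha
    · have : Continuous fun w => ∫ z in y..x, V r (x - z) * V (r + q) (z - w) :=
        intervalIntegral.continuous_parametric_intervalIntegral_of_continuous' (by fun_prop) _ _
      fun_prop
    · simp only [hWWV w hw.2, hgen w hw.1, hfF w hw.1.le]
  have hlt : ∀ a ∈ Ioo kl y, -(WW x a * (q * v a - χ a)) < 0 := fun a ha =>
    neg_neg_of_pos (mul_pos (hWWpos a ha.2) (hgenpos a ha.1))
  refine ⟨fun a ha => ⟨hder a ha, hlt a ha⟩, ?_⟩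
  refine strictAntiOn_of_deriv_neg (convex_Ioo kl y)
    (fun a ha => (hder a ha).continuousAt.continuousWithinAt) fun a ha => ?_
  rw [interior_Ioo] at ha
  rw [(hder a ha).deriv]
  exact hlt a ha
end

section
/- Assume ψ(1) = r and fix y > k̲. Define T(a) = e^{−a} + q ∫_{(a,y)} e^{−z} W^{(r+q)}(z − a) dz and Δ_∞(a; y) = ∫_{(a,y)} T(w)·( χ(w) − q·v̲(w) ) dw + ∫_{[y,∞)} e^{−w}·χ(w) dw. Then for every a ∈ (k̲, y) one has ∂_a Δ_∞(a; y) = T(a)·( q·v̲(a) − χ(a) ) > 0; consequently Δ_∞(·; y) is strictly increasing on (k̲, y) and the equation Δ_∞(a; y) = 0 has at most one solution a ∈ (k̲, y). -/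
open MeasureTheory Real Set Filter Topology

theorem exp_sub_one_sub_le_sq_div_two {t : ℝ} (ht : t ≤ 0) :
    Real.exp t - 1 - t ≤ t ^ 2 / 2 := by
  have h1 := Real.quadratic_le_exp_of_nonneg (x := -t) (by linarith)
  have h2 : Real.exp t * Real.exp (-t) = 1 := by rw [← Real.exp_add]; simp
  have h3 := Real.exp_pos t
  nlinarith [mul_le_mul_of_nonneg_left h1 h3.le, sq_nonneg (t ^ 2), sq_nonneg (1 + t),
    mul_le_mul_of_nonneg_left (mul_le_mul_of_nonneg_left h1 h3.le)
      (show 0 ≤ 1 + t + t ^ 2 / 2 by nlinarith [sq_nonneg (1 + t)]),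
    mul_nonneg h3.le (sq_nonneg (t ^ 2))]

theorem ae_neg_of_measure_Ici_zero {ν : Measure ℝ} (hν : ν (Set.Ici 0) = 0) :
    ∀ᵐ z ∂ν, z < 0 := by
  rw [ae_iff]
  convert hν using 2
  ext z
  simp

theorem integrable_levy_integrand {ν : Measure ℝ} (hν : ν (Set.Ici 0) = 0)
    (hνint : ∫⁻ x, ENNReal.ofReal (min 1 (x ^ 2)) ∂ν ≠ ⊤) {β : ℝ} (hβ : 0 ≤ β) :
    Integrable (fun z => Real.exp (β * z) - 1 -
      Set.indicator (Set.Ioi (-1 : ℝ)) (fun t => β * t) z) ν := by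
  have hmin : Integrable (fun x : ℝ => min 1 (x ^ 2)) ν := by
    refine ⟨by fun_prop, ?_⟩
    rw [hasFiniteIntegral_iff_ofReal (ae_of_all _ fun x => by positivity)]
    exact hνint.lt_top
  have hmeas : Measurable (fun z => Real.exp (β * z) - 1 -
      Set.indicator (Set.Ioi (-1 : ℝ)) (fun t => β * t) z) := by
    have : Measurable (Set.indicator (Set.Ioi (-1 : ℝ)) (fun t => β * t)) :=
      (by fun_prop : Measurable fun t : ℝ => β * t).indicator measurableSet_Ioi
    fun_prop
  refine (hmin.const_mul (1 + β ^ 2)).mono' hmeas.aestronglyMeasurable ?_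
  filter_upwards [ae_neg_of_measure_Ici_zero hν] with z hz
  have hβz : β * z ≤ 0 := mul_nonpos_of_nonneg_of_nonpos hβ hz.le
  rw [Real.norm_eq_abs, abs_le]
  by_cases hz1 : -1 < z
  · rw [Set.indicator_of_mem (Set.mem_Ioi.2 hz1), min_eq_right (by nlinarith)]
    have h1 := exp_sub_one_sub_le_sq_div_two hβz
    have h2 := Real.add_one_le_exp (β * z)
    constructor <;> nlinarith [sq_nonneg z, sq_nonneg (β * z)]
  · rw [Set.indicator_of_notMem (by simpa using hz1), min_eq_left (by nlinarith)]
    have h1 := Real.exp_le_one_iff.2 hβz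
    have h2 := Real.exp_pos (β * z)
    constructor <;> nlinarith [sq_nonneg β]

/-- The truncation term cancels in `e^{pz} - p e^z + p - 1`. -/
theorem levy_integrand_sub (p z : ℝ) :
    (Real.exp (p * z) - 1 - Set.indicator (Set.Ioi (-1 : ℝ)) (fun t => p * t) z) -
      p * (Real.exp (1 * z) - 1 - Set.indicator (Set.Ioi (-1 : ℝ)) (fun t => 1 * t) z) =
    Real.exp (p * z) - p * Real.exp z + p - 1 := by
  by_cases hz : z ∈ Set.Ioi (-1 : ℝ) <;> simp [hz] <;> ring

theorem antitoneOn_exp_mul_sub {p : ℝ} (hp : 1 < p) :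
    AntitoneOn (fun u => Real.exp (p * u) - p * Real.exp u + p - 1) (Set.Iic 0) := by
  have hd : ∀ u : ℝ, HasDerivAt (fun u => Real.exp (p * u) - p * Real.exp u + p - 1)
      (p * (Real.exp (p * u) - Real.exp u)) u := by
    intro u
    have h1 : HasDerivAt (fun u => Real.exp (p * u)) (Real.exp (p * u) * (p * 1)) u :=
      ((hasDerivAt_id u).const_mul p).exp
    exact (((h1.sub ((Real.hasDerivAt_exp u).const_mul p)).add_const p).sub_const 1).congr_deriv
      (by ring)
  refine antitoneOn_of_deriv_nonpos (convex_Iic 0) (by fun_prop)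
    (fun u _ => (hd u).differentiableAt.differentiableWithinAt) fun u hu => ?_
  rw [interior_Iic, Set.mem_Iio] at hu
  rw [(hd u).deriv]
  have : Real.exp (p * u) ≤ Real.exp u := Real.exp_le_exp.2 (by nlinarith)
  nlinarith

/-- Translates of a nonnegative antitone continuous function integrate continuously. -/
theorem continuousOn_integral_translate {ν : Measure ℝ} {g : ℝ → ℝ} (hg : Continuous g)
    (hanti : Antitone g) (hnn : ∀ u, 0 ≤ g u) (hint : Integrable g ν) :
    ContinuousOn (fun x => ∫ w, g (x + w) ∂ν) (Set.Ici 0) := by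
  refine continuousOn_of_dominated (bound := g) (fun x _ => by fun_prop) (fun x hx => ?_) hint
    (ae_of_all _ fun w => by fun_prop)
  refine ae_of_all _ fun w => ?_
  rw [Real.norm_of_nonneg (hnn _)]
  exact hanti (by linarith [Set.mem_Ici.1 hx])

theorem integral_translate_le {ν : Measure ℝ} {g : ℝ → ℝ} (hg : Continuous g)
    (hanti : Antitone g) (hnn : ∀ u, 0 ≤ g u) (hint : Integrable g ν) {x : ℝ} (hx : 0 ≤ x) :
    ∫ w, g (x + w) ∂ν ≤ ∫ w, g w ∂ν := by
  have hle : ∀ w, g (x + w) ≤ g w := fun w => hanti (by linarith)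
  refine integral_mono (hint.mono' (by fun_prop) (ae_of_all _ fun w => ?_)) hint hle
  rw [Real.norm_of_nonneg (hnn _)]
  exact hle w

theorem continuousOn_exp_add_integral_scale {w : ℝ → ℝ} (hw : ContinuousOn w (Set.Ici 0))
    (q y : ℝ) :
    ContinuousOn (fun b => Real.exp (-b) + q * ∫ z in Set.Ioo b y, Real.exp (-z) * w (z - b))
      (Set.Iic y) := by
  let w₀ : ℝ → ℝ := fun u => Real.exp (-u) * w (max u 0)
  have hw₀ : Continuous w₀ := by
    have : Continuous fun u : ℝ => w (max u 0) :=
      hw.comp_continuous (by fun_prop) fun u => le_max_right u 0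
    exact (Real.continuous_exp.comp continuous_neg).mul this
  have hprim : Continuous fun x => ∫ u in (0 : ℝ)..x, w₀ u :=
    intervalIntegral.continuous_primitive (fun a b => hw₀.intervalIntegrable a b) 0
  have hcont : Continuous fun b =>
      Real.exp (-b) + q * (Real.exp (-b) * ∫ u in (0 : ℝ)..(y - b), w₀ u) := by
    have := hprim.comp (continuous_const.sub continuous_id : Continuous fun b : ℝ => y - b)
    simp only [Function.comp_def] at this
    fun_prop
  refine hcont.continuousOn.congr fun b hb => ?_
  have hb' : b ≤ y := hb
  have hshift := intervalIntegral.integral_comp_sub_right (a := b) (b := y) w₀ b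
  rw [sub_self] at hshift
  simp only
  rw [← hshift, ← intervalIntegral.integral_const_mul,
    intervalIntegral.integral_of_le hb', integral_Ioc_eq_integral_Ioo]
  congr 2
  refine setIntegral_congr_fun measurableSet_Ioo fun z hz => ?_
  simp only [w₀]
  rw [max_eq_left (by linarith [hz.1]), ← mul_assoc, ← Real.exp_add]
  congr 2
  ring

theorem hasDerivAt_integral_Ioo_left {G : ℝ → ℝ} {k a y : ℝ}
    (hG : ContinuousOn G (Set.Icc k y)) (ha : a ∈ Set.Ioo k y) :
    HasDerivAt (fun b => ∫ w in Set.Ioo b y, G w) (-G a) a := by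
  have hint : IntervalIntegrable G volume a y :=
    (hG.mono (by rw [Set.uIcc_of_le ha.2.le]; exact Set.Icc_subset_Icc_left ha.1.le)
      ).intervalIntegrable
  have hopen : ContinuousOn G (Set.Ioo k y) := hG.mono Set.Ioo_subset_Icc_self
  have hd := intervalIntegral.integral_hasDerivAt_left hint
    (hopen.stronglyMeasurableAtFilter isOpen_Ioo a ha)
    (hopen.continuousAt (isOpen_Ioo.mem_nhds ha))
  refine hd.congr_of_eventuallyEq ?_
  filter_upwards [isOpen_Ioo.mem_nhds ha] with b hb
  rw [intervalIntegral.integral_of_le hb.2.le, integral_Ioc_eq_integral_Ioo]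


/-- Uniqueness of the solution to (5.7) (`eq:a_infty`) in the martingale case
`ψ(1) = r`: with `T(a) = e^{−a} + q∫_{(a,y)} e^{−z}W^{(r+q)}(z−a) dz` and
`Δ_∞(a;y) = ∫_{(a,y)} T(w)(χ(w) − q·v̲(w)) dw + ∫_{[y,∞)} e^{−w}χ(w) dw`, one
has `∂_a Δ_∞(a;y) = T(a)(q·v̲(a) − χ(a)) > 0` on `(k̲, y)`, so `Δ_∞(·;y)` is
strictly increasing there and has at most one zero. -/
theorem stmt15
    (μ σ : ℝ) (ν : MeasureTheory.Measure ℝ)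
    (hν : ν (Set.Ici 0) = 0)
    (hνint : ∫⁻ x, ENNReal.ofReal (min 1 (x ^ 2)) ∂ν ≠ ⊤)
    (ψ : ℝ → ℝ)
    (hψ : ∀ β : ℝ, 0 ≤ β →
      ψ β = μ * β + σ ^ 2 / 2 * β ^ 2 +
        ∫ z, (Real.exp (β * z) - 1 -
          Set.indicator (Set.Ioi (-1 : ℝ)) (fun t => β * t) z) ∂ν)
    (Φ : ℝ → ℝ)
    (hΦ : ∀ s : ℝ, 0 ≤ s → 0 ≤ Φ s ∧ ψ (Φ s) = s ∧ ∀ β : ℝ, Φ s < β → s < ψ β)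
    (r q : ℝ) (hr : 0 < r) (hq : 0 < q)
    (W : ℝ → ℝ → ℝ)
    (hWnn : ∀ s : ℝ, 0 ≤ s → ∀ x : ℝ, 0 ≤ W s x)
    (hWzero : ∀ s : ℝ, 0 ≤ s → ∀ x : ℝ, x < 0 → W s x = 0)
    (hWpos : ∀ s : ℝ, 0 ≤ s → ∀ x : ℝ, 0 < x → 0 < W s x)
    (hWcont : ∀ s : ℝ, 0 ≤ s → ContinuousOn (W s) (Set.Ici 0))
    (hWmono : ∀ s : ℝ, 0 ≤ s → MonotoneOn (W s) (Set.Ici 0))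
    (hWlap : ∀ s : ℝ, 0 ≤ s → ∀ β : ℝ, Φ s < β →
      ∫ x in Set.Ioi (0 : ℝ), Real.exp (-β * x) * W s x = 1 / (ψ β - s))
    (hmart : ψ 1 = r)
    (K : ℝ) (hK : 0 < K)
    (Kl kl : ℝ)
    (hKl : Kl = Φ (r + q) * K / (Φ (r + q) - 1))
    (hkl : kl = Real.log Kl)
    (v : ℝ → ℝ)
    (hv1 : ∀ x : ℝ, x ≤ kl → v x = (Kl - K) * Real.exp (Φ (r + q) * (x - kl)))
    (hv2 : ∀ x : ℝ, kl < x → v x = Real.exp x - K)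
    (h : ℝ → ℝ) (hh : ∀ x : ℝ, h x = v x - (Real.exp x - K))
    (h' : ℝ → ℝ) (hh' : ∀ x : ℝ, HasDerivAt h (h' x) x)
    (f : ℝ → ℝ)
    (hf : ∀ x : ℝ, kl ≤ x → f x = ∫ w in Set.Iio (kl - x), h (x + w) ∂ν)
    (χ : ℝ → ℝ)
    (hχ1 : ∀ x : ℝ, kl ≤ x → χ x = r * K - (r - ψ 1) * Real.exp x + f x)
    (hχ2 : ∀ x : ℝ, x < kl → χ x = q * v x)
    (y : ℝ) (hy : kl < y)
    (T : ℝ → ℝ)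
    (hT : ∀ b : ℝ, T b =
      Real.exp (-b) + q * ∫ z in Set.Ioo b y, Real.exp (-z) * W (r + q) (z - b))
    (Dinf : ℝ → ℝ)
    (hDinf : ∀ b : ℝ, Dinf b =
      (∫ w in Set.Ioo b y, T w * (χ w - q * v w)) +
        ∫ w in Set.Ici y, Real.exp (-w) * χ w) :
    (∀ a ∈ Set.Ioo kl y,
      HasDerivAt Dinf (T a * (q * v a - χ a)) a ∧ 0 < T a * (q * v a - χ a)) ∧
    StrictMonoOn Dinf (Set.Ioo kl y) ∧
    (∀ a₁ ∈ Set.Ioo kl y, ∀ a₂ ∈ Set.Ioo kl y,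
      Dinf a₁ = 0 → Dinf a₂ = 0 → a₁ = a₂) := by
  have hrq : 0 ≤ r + q := by linarith
  obtain ⟨hp0, hψp, hΦlt⟩ := hΦ (r + q) hrq
  set p := Φ (r + q) with hp
  have hp1 : 1 < p := by
    by_contra! hle
    rcases hle.lt_or_eq with hlt | heq
    · linarith [hΦlt 1 hlt]
    · rw [heq] at hψp; linarith
  have hpm : 0 < p - 1 := by linarith
  have hKlpos : 0 < Kl := by rw [hKl]; positivity
  have hexpkl : Real.exp kl = Kl := by rw [hkl, Real.exp_log hKlpos]
  set c := K / (p - 1) with hc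
  have hcpos : 0 < c := by positivity
  have hKc : K = c * (p - 1) := by rw [hc]; field_simp
  have hKlc : Kl = p * c := by rw [hKl, hc]; ring
  let P : ℝ → ℝ := fun u => Real.exp (p * u) - p * Real.exp u + p - 1
  let g : ℝ → ℝ := fun u => c * P (min u 0)
  have hP0 : P 0 = 0 := by simp [P]
  have hgcont : Continuous g := by fun_prop
  have hganti : Antitone g := fun u u' huu => mul_le_mul_of_nonneg_left
    (antitoneOn_exp_mul_sub hp1 (min_le_right u 0) (min_le_right u' 0)
      (min_le_min_right 0 huu)) hcpos.le
  have hgzero : ∀ u, 0 ≤ u → g u = 0 := fun u hu => by simp [g, min_eq_right hu, hP0]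
  have hgnn : ∀ u, 0 ≤ g u := fun u => by
    rcases le_total 0 u with hu | hu
    · exact (hgzero u hu).ge
    · exact (hgzero 0 le_rfl).ge.trans (hganti hu)
  have hhg : ∀ x, h x = g (x - kl) := by
    intro x
    rw [hh]
    rcases le_or_gt x kl with hx | hx
    · have hex : Real.exp x = Kl * Real.exp (x - kl) := by
        rw [← hexpkl, ← Real.exp_add]; congr 1; ring
      rw [hv1 x hx, hex]
      simp only [g, P]
      rw [min_eq_left (by linarith), hKlc, hKc]
      ring
    · rw [hv2 x hx, hgzero _ (by linarith)]; ring
  have hneg := ae_neg_of_measure_Ici_zero hν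
  have hLp := integrable_levy_integrand hν hνint hp0
  have hL1 := integrable_levy_integrand hν hνint zero_le_one
  have hPae : P =ᵐ[ν] fun z =>
      (Real.exp (p * z) - 1 - Set.indicator (Set.Ioi (-1 : ℝ)) (fun t => p * t) z) -
      p * (Real.exp (1 * z) - 1 - Set.indicator (Set.Ioi (-1 : ℝ)) (fun t => 1 * t) z) :=
    ae_of_all _ fun z => (levy_integrand_sub p z).symm
  have hPint : Integrable P ν := (hLp.sub (hL1.const_mul p)).congr hPae.symm
  have hgae : g =ᵐ[ν] fun z => c * P z := by
    filter_upwards [hneg] with z hz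
    simp only [g, min_eq_left hz.le]
  have hgint : Integrable g ν := (hPint.const_mul c).congr hgae.symm
  have hgval : ∫ z, g z ∂ν = c * (r + q - p * r - σ ^ 2 / 2 * (p ^ 2 - p)) := by
    have e1 := hψ p hp0
    have e2 := hψ 1 zero_le_one
    rw [integral_congr_ae hgae, integral_const_mul, integral_congr_ae hPae,
      integral_sub hLp (hL1.const_mul p), integral_const_mul]
    rw [hψp] at e1
    rw [hmart] at e2
    congr 1
    linear_combination -e1 + p * e2
  have hfg : ∀ x, kl ≤ x → f x = ∫ w, g ((x - kl) + w) ∂ν := by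
    intro x hx
    rw [hf x hx, ← integral_indicator measurableSet_Iio]
    congr 1
    ext w
    by_cases hw : w ∈ Set.Iio (kl - x)
    · rw [Set.indicator_of_mem hw, hhg]; congr 1; ring
    · rw [Set.indicator_of_notMem hw, hgzero]
      simp only [Set.mem_Iio, not_lt] at hw
      linarith
  have hχf : ∀ x, kl ≤ x → χ x = r * K + ∫ w, g ((x - kl) + w) ∂ν := by
    intro x hx
    rw [hχ1 x hx, hfg x hx, hmart]; ring
  have hχcont : ContinuousOn χ (Set.Ici kl) := by
    have := (continuousOn_integral_translate hgcont hganti hgnn hgint).comp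
      (f := fun x : ℝ => x - kl) (s := Set.Ici kl) (by fun_prop)
      (fun x hx => sub_nonneg.2 (Set.mem_Ici.1 hx))
    exact (continuousOn_const.add this).congr hχf
  have hvcont : Continuous v := by
    have : v = fun x => g (x - kl) + (Real.exp x - K) := by
      ext x; rw [← hhg, hh]; ring
    rw [this]; fun_prop
  have hTcont : ContinuousOn T (Set.Iic y) :=
    (continuousOn_exp_add_integral_scale (hWcont _ hrq) q y).congr fun b _ => hT b
  have hTpos : ∀ b, 0 < T b := by
    intro b
    rw [hT]
    have : 0 ≤ ∫ z in Set.Ioo b y, Real.exp (-z) * W (r + q) (z - b) :=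
      integral_nonneg fun z => mul_nonneg (Real.exp_pos _).le (hWnn _ hrq _)
    have := Real.exp_pos (-b)
    positivity
  have hGcont : ContinuousOn (fun w => T w * (χ w - q * v w)) (Set.Icc kl y) :=
    (hTcont.mono Set.Icc_subset_Iic_self).mul
      ((hχcont.mono Set.Icc_subset_Ici_self).sub (hvcont.continuousOn.const_mul q))
  have hpos : ∀ a ∈ Set.Ioo kl y, 0 < T a * (q * v a - χ a) := by
    intro a ha
    refine mul_pos (hTpos a) ?_
    have h1 := integral_translate_le hgcont hganti hgnn hgint (sub_nonneg.2 ha.1.le)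
    have h2 : p * c < Real.exp a := by
      rw [← hKlc, ← hexpkl]; exact Real.exp_lt_exp.2 ha.1
    have h3 : 0 ≤ c * (σ ^ 2 / 2 * (p ^ 2 - p)) := by
      have : 0 ≤ p ^ 2 - p := by nlinarith
      positivity
    rw [hv2 a ha.1, hχf a ha.1.le]
    rw [hgval] at h1
    rw [hKc]
    nlinarith [mul_lt_mul_of_pos_left h2 hq]
  have hderiv : ∀ a ∈ Set.Ioo kl y, HasDerivAt Dinf (T a * (q * v a - χ a)) a := by
    intro a ha
    have := (hasDerivAt_integral_Ioo_left hGcont ha).add_const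
      (∫ w in Set.Ici y, Real.exp (-w) * χ w)
    rw [show Dinf = _ from funext hDinf]
    exact this.congr_deriv (by ring)
  have hmono : StrictMonoOn Dinf (Set.Ioo kl y) := by
    refine strictMonoOn_of_deriv_pos (convex_Ioo kl y)
      (fun a ha => (hderiv a ha).continuousAt.continuousWithinAt) fun a ha => ?_
    rw [interior_Ioo] at ha
    rw [(hderiv a ha).deriv]
    exact hpos a ha
  exact ⟨fun a ha => ⟨hderiv a ha, hpos a ha⟩, hmono,
    fun a₁ h₁ a₂ h₂ e₁ e₂ => hmono.injOn h₁ h₂ (e₁.trans e₂.symm)⟩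
end
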